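/- For every integer n ≥ 2 and every 1 ≤ k ≤ n, the following recurrences hold: P^B_{n,k} = 2k·Q^B_{n-1,k} + (2n−2k+1)·Q^B_{n-1,k-1} + P^B_{n-1,k}, and Q^B_{n,k} = 2k·P^B_{n-1,k} + (2n−2k+1)·P^B_{n-1,k-1} + Q^B_{n-1,k} (with the convention that P^B_{n-1,j} = Q^B_{n-1,j} = 0 when j < 0 or j > n-1). -/

import Mathlib

/-- An element of the hyperoctahedral group `B_n`, encoded as a pair `(σ, ε)` of a
permutation of `Fin n` and a sign vector: the corresponding signed permutation sends
`i+1` (for `i : Fin n`) to `±(σ(i)+1)`, and `-(i+1)` to `∓(σ(i)+1)`. -/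
abbrev SignedPerm (n : ℕ) := Equiv.Perm (Fin n) × (Fin n → Bool)

/-- The value `π(i+1) ∈ {-n,…,-1,1,…,n}` of the signed permutation at `i+1`. -/
def valB {n : ℕ} (p : SignedPerm n) (i : Fin n) : ℤ :=
  if p.2 i then -((p.1 i : ℤ) + 1) else (p.1 i : ℤ) + 1

/-- The signed permutation as a function on `ℤ` (value `0` outside `{-n,…,-1,1,…,n}`;
in particular `π(0) = 0`). -/
def appB {n : ℕ} (p : SignedPerm n) (x : ℤ) : ℤ :=
  if h : 1 ≤ x ∧ x ≤ (n : ℤ) then valB p ⟨x.toNat - 1, by omega⟩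
  else if h' : 1 ≤ -x ∧ -x ≤ (n : ℤ) then -(valB p ⟨(-x).toNat - 1, by omega⟩)
  else 0

/-- Type B inversions:
`inv_B(π) = |{i<j : π(i)>π(j)}| + |{i<j : -π(i)>π(j)}| + |{i : π(i)<0}|`. -/
def invB {n : ℕ} (p : SignedPerm n) : ℕ :=
  (Finset.univ.filter (fun ij : Fin n × Fin n =>
      ij.1 < ij.2 ∧ valB p ij.1 > valB p ij.2)).card +
  (Finset.univ.filter (fun ij : Fin n × Fin n =>
      ij.1 < ij.2 ∧ -valB p ij.1 > valB p ij.2)).card +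
  (Finset.univ.filter (fun i : Fin n => valB p i < 0)).card

/-- Type B excedances (Brenti):
`exc_B(π) = |{i ∈ [n] : π(|π(i)|) > π(i)}| + |{i ∈ [n] : π(i) = -i}|`. -/
def excB {n : ℕ} (p : SignedPerm n) : ℕ :=
  (Finset.univ.filter (fun i : Fin n => appB p |valB p i| > valB p i)).card +
  (Finset.univ.filter (fun i : Fin n => valB p i = -((i : ℤ) + 1))).card

/-- Type B descents (with the convention `π(0) = 0`):
`des_B(π) = |{i ∈ {0,…,n-1} : π(i) > π(i+1)}|`. -/
def desB {n : ℕ} (p : SignedPerm n) : ℕ :=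
  (Finset.univ.filter (fun i : Fin n => appB p (i : ℤ) > appB p ((i : ℤ) + 1))).card

/-- `PB n k`: number of elements of `B_n^+` (even `inv_B`) with `k` type B excedances. -/
def PB (n k : ℕ) : ℕ :=
  (Finset.univ.filter (fun p : SignedPerm n => Even (invB p) ∧ excB p = k)).card

/-- `QB n k`: number of elements of `B_n^-` (odd `inv_B`) with `k` type B excedances. -/
def QB (n k : ℕ) : ℕ :=
  (Finset.univ.filter (fun p : SignedPerm n => ¬ Even (invB p) ∧ excB p = k)).card

/-- `Bp n k`: number of elements of `B_n^+` with `k` type B descents. -/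
def Bp (n k : ℕ) : ℕ :=
  (Finset.univ.filter (fun p : SignedPerm n => Even (invB p) ∧ desB p = k)).card

/-- `Bm n k`: number of elements of `B_n^-` with `k` type B descents. -/
def Bm (n k : ℕ) : ℕ :=
  (Finset.univ.filter (fun p : SignedPerm n => ¬ Even (invB p) ∧ desB p = k)).card

open Finset

/-- The extension of a permutation of `Fin n` to `Fin (n + 1)` fixing the last element. -/
def extendLast {n : ℕ} (σ : Equiv.Perm (Fin n)) : Equiv.Perm (Fin (n + 1)) :=
  finSuccEquivLast.symm.permCongr (Equiv.optionCongr σ)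

@[simp] lemma extendLast_castSucc {n : ℕ} (σ : Equiv.Perm (Fin n)) (i : Fin n) :
    extendLast σ i.castSucc = (σ i).castSucc := by
  simp [extendLast, Equiv.permCongr_apply]

@[simp] lemma extendLast_last {n : ℕ} (σ : Equiv.Perm (Fin n)) :
    extendLast σ (Fin.last n) = Fin.last n := by
  simp [extendLast, Equiv.permCongr_apply]

@[simp] lemma extendLast_symm_castSucc {n : ℕ} (σ : Equiv.Perm (Fin n)) (i : Fin n) :
    (extendLast σ).symm i.castSucc = (σ.symm i).castSucc := by
  simp [Equiv.symm_apply_eq]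

@[simp] lemma extendLast_symm_last {n : ℕ} (σ : Equiv.Perm (Fin n)) :
    (extendLast σ).symm (Fin.last n) = Fin.last n := by
  simp [Equiv.symm_apply_eq]

@[simp] lemma sign_extendLast {n : ℕ} (σ : Equiv.Perm (Fin n)) :
    Equiv.Perm.sign (extendLast σ) = Equiv.Perm.sign σ := by
  simp [extendLast]

/-- The signed permutation of size `n + 1` that extends `p` by `n + 1 ↦ ±(n + 1)` (with the sign
given by `b`), precomposed with the transposition of the positions `o` and `n + 1`. -/
def insertLast {n : ℕ} (x : Fin (n + 1) × Bool × SignedPerm n) : SignedPerm (n + 1) :=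
  (extendLast x.2.2.1 * Equiv.swap x.1 (Fin.last n),
    fun j => (Fin.snoc x.2.2.2 x.2.1 : Fin (n + 1) → Bool) (Equiv.swap x.1 (Fin.last n) j))

lemma insertLast_injective {n : ℕ} : Function.Injective (insertLast (n := n)) := by
  rintro ⟨o, b, σ, ε⟩ ⟨o', b', σ', ε'⟩ h
  obtain ⟨h1, h2⟩ := Prod.ext_iff.1 h
  simp only [insertLast] at h1 h2
  have ho : o = o' := by
    have h3 := congrArg (fun τ : Equiv.Perm (Fin (n + 1)) => τ.symm (Fin.last n)) h1
    simpa [Equiv.Perm.mul_def] using h3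
  subst ho
  have hσ : σ = σ' := by
    have h3 := mul_right_cancel h1
    ext i
    simpa using congrArg Fin.val (DFunLike.congr_fun h3 i.castSucc)
  have hs : ∀ j, (Fin.snoc ε b : Fin (n + 1) → Bool) j = (Fin.snoc ε' b' : Fin (n + 1) → Bool) j := by
    intro j
    simpa using congrFun h2 (Equiv.swap o (Fin.last n) j)
  have hb : b = b' := by simpa using hs (Fin.last n)
  have hε : ε = ε' := by
    funext i
    simpa using hs i.castSucc
  rw [hσ, hb, hε]

lemma insertLast_bijective {n : ℕ} : Function.Bijective (insertLast (n := n)) := by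
  rw [Fintype.bijective_iff_injective_and_card]
  refine ⟨insertLast_injective, ?_⟩
  simp [Fintype.card_perm, Nat.factorial_succ, pow_succ]
  ring

/-- The sign character of the hyperoctahedral group. -/
def signB {n : ℕ} (p : SignedPerm n) : ℤ :=
  Equiv.Perm.sign p.1 * ∏ i, if p.2 i then -1 else 1

lemma signB_insertLast {n : ℕ} (o : Fin (n + 1)) (b : Bool) (p : SignedPerm n) :
    signB (insertLast (o, b, p)) =
      (if o = Fin.last n then 1 else -1) * (if b then -1 else 1) * signB p := by
  have h := Equiv.prod_comp (Equiv.swap o (Fin.last n))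
    (fun j => if (Fin.snoc p.2 b : Fin (n + 1) → Bool) j then (-1 : ℤ) else 1)
  rw [signB, signB, show (∏ j, if (insertLast (o, b, p)).2 j then (-1 : ℤ) else 1) = _ from h,
    Fin.prod_univ_castSucc]
  simp only [insertLast, Fin.snoc_castSucc, Fin.snoc_last, Equiv.Perm.sign_mul, sign_extendLast,
    Equiv.Perm.sign_swap']
  split_ifs <;> simp

lemma abs_valB {n : ℕ} (p : SignedPerm n) (i : Fin n) : |valB p i| = (p.1 i : ℤ) + 1 := by
  unfold valB
  split_ifs
  · rw [abs_neg, abs_of_nonneg (by positivity)]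
  · rw [abs_of_nonneg (by positivity)]

lemma valB_bounds {n : ℕ} (p : SignedPerm n) (i : Fin n) : -(n : ℤ) ≤ valB p i ∧ valB p i ≤ n := by
  rw [← abs_le, abs_valB]
  omega

lemma appB_abs_valB {n : ℕ} (p : SignedPerm n) (i : Fin n) :
    appB p |valB p i| = valB p (p.1 i) := by
  rw [abs_valB, appB, dif_pos (by omega)]
  congr 1

/-- The positions counted by the excedance statistic, indexed by the points `|π(i)|`. -/
def IsExcedance {n : ℕ} (p : SignedPerm n) (j : Fin n) : Prop :=
  valB p (p.1.symm j) < valB p j ∨ valB p j = -((j : ℤ) + 1)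

open Classical in
lemma excB_eq_sum {n : ℕ} (p : SignedPerm n) :
    excB p = ∑ j, if IsExcedance p j then 1 else 0 := by
  have h : (univ.filter (fun i : Fin n => appB p |valB p i| > valB p i)).card =
      ∑ j, if valB p (p.1.symm j) < valB p j then 1 else 0 := by
    rw [card_filter, ← Equiv.sum_comp p.1 (fun j => if valB p (p.1.symm j) < valB p j then 1 else 0)]
    simp [appB_abs_valB]
  rw [excB, h, card_filter, ← sum_add_distrib]
  refine sum_congr rfl fun j _ => ?_
  have hx : valB p j = -((j : ℤ) + 1) → p.1.symm j = j := by
    intro hv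
    have := abs_valB p j
    rw [hv, abs_neg, abs_of_nonneg (by positivity)] at this
    rw [Equiv.symm_apply_eq]
    ext
    omega
  unfold IsExcedance
  by_cases h2 : valB p j = -((j : ℤ) + 1)
  · simp [hx h2, h2]
  · simp only [h2, or_false, if_false, add_zero]

lemma valB_insertLast_last_last {n : ℕ} (b : Bool) (p : SignedPerm n) :
    valB (insertLast (Fin.last n, b, p)) (Fin.last n) =
      if b then -((n : ℤ) + 1) else (n : ℤ) + 1 := by
  simp [valB, insertLast]

lemma valB_insertLast {n : ℕ} (o : Fin (n + 1)) (b : Bool) (p : SignedPerm n) (j : Fin (n + 1)) :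
    valB (insertLast (o, b, p)) j =
      valB (insertLast (Fin.last n, b, p)) (Equiv.swap o (Fin.last n) j) := by
  simp [valB, insertLast]

lemma valB_insertLast_last_castSucc {n : ℕ} (b : Bool) (p : SignedPerm n) (j : Fin n) :
    valB (insertLast (Fin.last n, b, p)) j.castSucc = valB p j := by
  simp [valB, insertLast]

lemma valB_insertLast_symm {n : ℕ} (o : Fin (n + 1)) (b : Bool) (p : SignedPerm n)
    (j : Fin (n + 1)) :
    valB (insertLast (o, b, p)) ((insertLast (o, b, p)).1.symm j) =
      valB (insertLast (Fin.last n, b, p)) ((extendLast p.1).symm j) := by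
  rw [valB_insertLast]
  simp [insertLast, Equiv.Perm.mul_def]

lemma isExcedance_insertLast {n : ℕ} (o : Fin (n + 1)) (b : Bool) (p : SignedPerm n)
    (j : Fin (n + 1)) :
    IsExcedance (insertLast (o, b, p)) j ↔
      valB (insertLast (Fin.last n, b, p)) ((extendLast p.1).symm j) <
        valB (insertLast (Fin.last n, b, p)) (Equiv.swap o (Fin.last n) j) ∨
      valB (insertLast (Fin.last n, b, p)) (Equiv.swap o (Fin.last n) j) = -((j : ℤ) + 1) := by
  rw [IsExcedance, valB_insertLast_symm, valB_insertLast o]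

lemma excB_insertLast_last {n : ℕ} (b : Bool) (p : SignedPerm n) :
    excB (insertLast (Fin.last n, b, p)) = excB p + if b then 1 else 0 := by
  classical
  rw [excB_eq_sum, excB_eq_sum, Fin.sum_univ_castSucc]
  congr 1
  · refine sum_congr rfl fun j _ => if_congr ?_ rfl rfl
    rw [isExcedance_insertLast]
    simp [valB_insertLast_last_castSucc, IsExcedance]
  · refine if_congr ?_ rfl rfl
    rw [isExcedance_insertLast]
    simp only [extendLast_symm_last, Equiv.swap_self, Equiv.refl_apply, valB_insertLast_last_last,
      Fin.val_last]
    cases b <;> simp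
    omega

open Classical in
lemma excB_insertLast_castSucc {n : ℕ} (i : Fin n) (b : Bool) (p : SignedPerm n) :
    excB (insertLast (i.castSucc, b, p)) =
      if IsExcedance p i then excB p else excB p + 1 := by
  have hlast : IsExcedance (insertLast (i.castSucc, b, p)) (Fin.last n) ↔ b = true := by
    rw [isExcedance_insertLast]
    simp only [extendLast_symm_last, Equiv.swap_apply_right, valB_insertLast_last_last,
      valB_insertLast_last_castSucc, Fin.val_last]
    have := valB_bounds p i
    cases b <;> simp <;> omega
  have hi : IsExcedance (insertLast (i.castSucc, b, p)) i.castSucc ↔ b = false := by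
    rw [isExcedance_insertLast]
    simp only [extendLast_symm_castSucc, Equiv.swap_apply_left, valB_insertLast_last_last,
      valB_insertLast_last_castSucc, Fin.val_castSucc]
    have := valB_bounds p (p.1.symm i)
    have := i.2
    cases b <;> simp <;> omega
  have hj : ∀ j ∈ univ.erase i,
      (if IsExcedance (insertLast (i.castSucc, b, p)) j.castSucc then 1 else 0) =
        if IsExcedance p j then 1 else 0 := by
    intro j hj
    refine if_congr ?_ rfl rfl
    have hne : j.castSucc ≠ i.castSucc := by simpa using hj
    rw [isExcedance_insertLast, Equiv.swap_apply_of_ne_of_ne hne (Fin.castSucc_lt_last j).ne]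
    simp [valB_insertLast_last_castSucc, IsExcedance]
  rw [excB_eq_sum, excB_eq_sum, Fin.sum_univ_castSucc, ← add_sum_erase _ _ (mem_univ i),
    sum_congr rfl hj, ← add_sum_erase (a := i) univ (fun j => if IsExcedance p j then 1 else 0)
      (mem_univ i)]
  simp only [hlast, hi]
  cases b <;> by_cases h : IsExcedance p i <;> simp [h] <;> omega

lemma neg_one_pow_invB {n : ℕ} (p : SignedPerm n) : (-1 : ℤ) ^ invB p = signB p := by
  have hneg : (-1 : ℤ) ^ (univ.filter (fun i : Fin n => valB p i < 0)).card =
      ∏ i, if p.2 i then -1 else 1 := by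
    rw [card_filter, ← prod_pow_eq_pow_sum]
    refine prod_congr rfl fun i _ => ?_
    by_cases h : p.2 i
    · have : valB p i < 0 := by simp only [valB, h, if_true]; omega
      simp [h, this]
    · have : ¬ valB p i < 0 := by simp only [valB, h]; simp; omega
      simp [h, this]
  rw [invB, pow_add, pow_add, hneg, signB]
  congr 1
  rw [card_filter, card_filter, ← prod_pow_eq_pow_sum, ← prod_pow_eq_pow_sum, ← prod_mul_distrib,
    Equiv.Perm.sign_eq_prod_prod_Ioi]
  push_cast
  rw [← univ_product_univ, prod_product]
  refine prod_congr rfl fun i _ => ?_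
  rw [← filter_lt_eq_Ioi, prod_filter]
  refine prod_congr rfl fun j _ => ?_
  by_cases hij : i < j
  · have hne : p.1 i ≠ p.1 j := fun h => hij.ne (p.1.injective h)
    have hne' : (p.1 i : ℕ) ≠ p.1 j := fun h => hne (Fin.ext h)
    simp only [hij, true_and, if_true, valB, Fin.lt_def]
    rcases lt_or_gt_of_ne hne' with h | h <;> cases p.2 i <;> cases p.2 j <;>
      simp <;> split_ifs <;> first | omega | simp
  · simp [hij]

/-- The signed count of the signed permutations with `k` excedances. -/
def signedExcCount (n k : ℕ) : ℤ := ∑ p : SignedPerm n, if excB p = k then signB p else 0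

/-- The number of signed permutations with `k` excedances. -/
def excCount (n k : ℕ) : ℤ := ∑ p : SignedPerm n, if excB p = k then 1 else 0

lemma PB_add_QB (n k : ℕ) : (PB n k : ℤ) + QB n k = excCount n k := by
  rw [PB, QB, excCount, card_filter, card_filter]
  push_cast
  rw [← sum_add_distrib]
  refine sum_congr rfl fun p _ => ?_
  by_cases h : Even (invB p) <;> simp [h]

lemma PB_sub_QB (n k : ℕ) : (PB n k : ℤ) - QB n k = signedExcCount n k := by
  rw [PB, QB, signedExcCount, card_filter, card_filter]
  push_cast
  rw [← sum_sub_distrib]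
  refine sum_congr rfl fun p _ => ?_
  rw [← neg_one_pow_invB]
  by_cases h : Even (invB p)
  · simp [h]
  · simp [h, (Nat.not_even_iff_odd.1 h).neg_one_pow, apply_ite]

lemma sum_signedPerm_succ {n : ℕ} (f : SignedPerm (n + 1) → ℤ) :
    ∑ p, f p = ∑ p : SignedPerm n, ∑ b : Bool,
      (∑ i : Fin n, f (insertLast (i.castSucc, b, p)) + f (insertLast (Fin.last n, b, p))) := by
  rw [← insertLast_bijective.sum_comp, Fintype.sum_prod_type, sum_comm, Fintype.sum_prod_type,
    sum_comm]
  simp only [Fin.sum_univ_castSucc]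

lemma signedExcCount_succ_zero (n : ℕ) : signedExcCount (n + 1) 0 = signedExcCount n 0 := by
  classical
  rw [signedExcCount, sum_signedPerm_succ, signedExcCount]
  refine sum_congr rfl fun p _ => ?_
  simp only [Fintype.sum_bool, signB_insertLast, excB_insertLast_last, excB_insertLast_castSucc]
  rw [add_add_add_comm, ← sum_add_distrib, sum_eq_zero]
  · simp
  · intro i _
    split_ifs <;> simp_all [Fin.castSucc_ne_last]

lemma signedExcCount_succ_succ (n k : ℕ) :
    signedExcCount (n + 1) (k + 1) = signedExcCount n (k + 1) - signedExcCount n k := by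
  classical
  rw [signedExcCount, sum_signedPerm_succ, signedExcCount, signedExcCount, ← sum_sub_distrib]
  refine sum_congr rfl fun p _ => ?_
  simp only [Fintype.sum_bool, signB_insertLast, excB_insertLast_last, excB_insertLast_castSucc]
  rw [add_add_add_comm, ← sum_add_distrib, sum_eq_zero]
  · simp
    split_ifs <;> simp
  · intro i _
    simp only [(Fin.castSucc_lt_last i).ne]
    split_ifs <;> simp_all

lemma signedExcCount_eq (n k : ℕ) : signedExcCount n k = (-1) ^ k * n.choose k := by
  induction n generalizing k with
  | zero =>
    have h (p : SignedPerm 0) : excB p = 0 := by simp [excB]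
    have hs (σ : Equiv.Perm (Fin 0)) : Equiv.Perm.sign σ = 1 := by
      rw [Subsingleton.elim σ 1, map_one]
    cases k <;> simp [signedExcCount, h, signB, hs]
  | succ n ih =>
    cases k with
    | zero => simp [signedExcCount_succ_zero, ih]
    | succ k =>
      rw [signedExcCount_succ_succ, ih, ih, Nat.choose_succ_succ]
      push_cast
      ring

lemma excCount_succ_succ (n k : ℕ) :
    excCount (n + 1) (k + 1) =
      (2 * k + 3) * excCount n (k + 1) + (2 * (n : ℤ) - 2 * k + 1) * excCount n k := by
  classical
  rw [excCount, sum_signedPerm_succ, excCount, excCount, mul_sum, mul_sum, ← sum_add_distrib]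
  refine sum_congr rfl fun p _ => ?_
  have hE : (∑ j, if IsExcedance p j then (1 : ℤ) else 0) = excB p := by
    rw [excB_eq_sum]
    push_cast
    rfl
  have hs : (∑ i : Fin n, if (if IsExcedance p i then excB p else excB p + 1) = k + 1
      then (1 : ℤ) else 0) =
      excB p * (if excB p = k + 1 then 1 else 0) +
        (n - excB p) * (if excB p = k then 1 else 0) := by
    have hn : (n : ℤ) = ∑ _j : Fin n, 1 := by simp
    rw [← hE, hn, ← sum_sub_distrib, sum_mul, sum_mul, ← sum_add_distrib]
    refine sum_congr rfl fun i _ => ?_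
    by_cases h : IsExcedance p i <;> simp [h]
  simp only [Fintype.sum_bool, excB_insertLast_last, excB_insertLast_castSucc, hs]
  by_cases h1 : excB p = k + 1
  · simp [h1]
    ring
  · by_cases h2 : excB p = k
    · simp [h2]
      ring
    · simp [h1, h2]

lemma mul_signedExcCount_succ (n k : ℕ) :
    ((k : ℤ) + 1) * signedExcCount n (k + 1) + ((n : ℤ) - k) * signedExcCount n k = 0 := by
  rw [signedExcCount_eq, signedExcCount_eq]
  have h : (n.choose (k + 1) : ℤ) * (k + 1) = n.choose k * (n - k) := by
    rcases le_or_gt k n with hk | hk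
    · have := Nat.choose_succ_right_eq n k
      zify [hk] at this
      exact this
    · simp [Nat.choose_eq_zero_of_lt hk, Nat.choose_eq_zero_of_lt (Nat.lt_succ_of_lt hk)]
  linear_combination (-1) ^ (k + 1) * h

/-- **Lemma.** For every `n ≥ 2` and `1 ≤ k ≤ n`:
`P^B_{n,k} = 2k·Q^B_{n-1,k} + (2n−2k+1)·Q^B_{n-1,k-1} + P^B_{n-1,k}` and
`Q^B_{n,k} = 2k·P^B_{n-1,k} + (2n−2k+1)·P^B_{n-1,k-1} + Q^B_{n-1,k}`. -/
theorem typeB_excedance_recurrence (n : ℕ) (hn : 2 ≤ n) (k : ℕ) (hk1 : 1 ≤ k)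
    (hk : k ≤ n) :
    (PB n k : ℤ) = 2 * k * (QB (n - 1) k : ℤ) +
        (2 * (n : ℤ) - 2 * k + 1) * (QB (n - 1) (k - 1) : ℤ) + (PB (n - 1) k : ℤ) ∧
      (QB n k : ℤ) = 2 * k * (PB (n - 1) k : ℤ) +
        (2 * (n : ℤ) - 2 * k + 1) * (PB (n - 1) (k - 1) : ℤ) + (QB (n - 1) k : ℤ) := by
  obtain ⟨m, rfl⟩ : ∃ m, n = m + 1 := ⟨n - 1, by omega⟩
  obtain ⟨j, rfl⟩ : ∃ j, k = j + 1 := ⟨k - 1, by omega⟩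
  simp only [Nat.add_sub_cancel]
  push_cast
  have hS := excCount_succ_succ m j
  have hD := signedExcCount_succ_succ m j
  have hC := mul_signedExcCount_succ m j
  simp only [← PB_add_QB, ← PB_sub_QB] at hS hD hC
  constructor
  · refine mul_left_cancel₀ (two_ne_zero (α := ℤ)) ?_
    linear_combination hS + hD + 2 * hC
  · refine mul_left_cancel₀ (two_ne_zero (α := ℤ)) ?_
    linear_combination hS - hD - 2 * hC
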